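/- arXiv:2412.00565 — 4 statements merged into one kernel-verified Lean document; each statement's English description precedes it below -/
import Mathlib

section
/- Let V be a variety that has a Taylor term. If V has a weak difference term, then there is a ternary L-term w such that whenever A ∈ V, T is an abelian tolerance on A, and (a,b) ∈ T, we have w^A(a,a,b) = b and w^A(b,a,a) = b (a 'weak difference term for tolerances'). -/
open FirstOrder.Language FirstOrder.Language.Structure

universe u v w

/-- A binary relation on `A` is compatible with all (interpreted) operations of the
`L`-structure `A`. -/
def Compatible (L : FirstOrder.Language.{u, v}) (A : Type w) [L.Structure A]
    (T : A → A → Prop) : Prop :=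
  ∀ (n : ℕ) (f : L.Functions n) (a b : Fin n → A),
    (∀ i, T (a i) (b i)) → T (funMap f a) (funMap f b)

/-- A tolerance on `A`: a reflexive, symmetric, compatible binary relation. -/
def IsTolerance (L : FirstOrder.Language.{u, v}) (A : Type w) [L.Structure A]
    (T : A → A → Prop) : Prop :=
  Reflexive T ∧ Symmetric T ∧ Compatible L A T

/-- A congruence on `A`: a transitive tolerance. -/
def IsCongruence (L : FirstOrder.Language.{u, v}) (A : Type w) [L.Structure A]
    (T : A → A → Prop) : Prop :=
  IsTolerance L A T ∧ Transitive T

/-- The centralizer condition `C(S, T; δ)`: for every term `t(x, y₁, …, yₙ)`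
(variable `0` playing the role of `x`), every `(a, b) ∈ S` and all pairs
`(uᵢ, vᵢ) ∈ T`, if `(t(a, ū), t(a, v̄)) ∈ δ` then `(t(b, ū), t(b, v̄)) ∈ δ`. -/
def Centralizes (L : FirstOrder.Language.{u, v}) (A : Type w) [L.Structure A]
    (S T δ : A → A → Prop) : Prop :=
  ∀ (n : ℕ) (t : L.Term (Fin (n + 1))) (a b : A), S a b →
    ∀ u v : Fin n → A, (∀ i, T (u i) (v i)) →
      (δ (t.realize (Fin.cons a u)) (t.realize (Fin.cons a v)) →
        δ (t.realize (Fin.cons b u)) (t.realize (Fin.cons b v)))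

/-- The algebra `A` satisfies every equation in the set `E` under every assignment:
membership in the variety axiomatized by `E`. -/
def SatisfiesEqs (L : FirstOrder.Language.{u, v}) (A : Type w) [L.Structure A]
    (E : Set (Σ n : ℕ, L.Term (Fin n) × L.Term (Fin n))) : Prop :=
  ∀ e ∈ E, ∀ val : Fin e.1 → A, e.2.1.realize val = e.2.2.realize val

/-- `wt` is a weak difference term for the variety axiomatized by `E`: for every
algebra `A` in the variety, every abelian congruence `α` on `A`, and every
`(a, b) ∈ α`, `wt(a, a, b) = b` and `wt(b, a, a) = b`. -/
def IsWeakDifferenceTerm (L : FirstOrder.Language.{u, v})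
    (E : Set (Σ n : ℕ, L.Term (Fin n) × L.Term (Fin n))) (wt : L.Term (Fin 3)) : Prop :=
  ∀ (A : Type w) [L.Structure A], SatisfiesEqs L A E →
    ∀ α : A → A → Prop, IsCongruence L A α → Centralizes L A α α Eq →
      ∀ a b : A, α a b → wt.realize ![a, a, b] = b ∧ wt.realize ![b, a, a] = b

/-- The variety axiomatized by `E` has a Taylor term: an idempotent term
`t(x₁, …, xₙ)`, `n ≥ 1`, such that for each `i` the variety satisfies an identity
`t(w₁, …, wₙ) ≈ t(z₁, …, zₙ)` with `wᵢ ≠ zᵢ` (variables indexed by `ℕ`). -/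
def HasTaylorTerm (L : FirstOrder.Language.{u, v})
    (E : Set (Σ n : ℕ, L.Term (Fin n) × L.Term (Fin n))) : Prop :=
  ∃ (n : ℕ) (t : L.Term (Fin n)), 0 < n ∧
    (∀ (A : Type w) [L.Structure A], SatisfiesEqs L A E →
      ∀ a : A, t.realize (fun _ => a) = a) ∧
    (∀ i : Fin n, ∃ wv zv : Fin n → ℕ, wv i ≠ zv i ∧
      ∀ (A : Type w) [L.Structure A], SatisfiesEqs L A E →
        ∀ val : ℕ → A, t.realize (val ∘ wv) = t.realize (val ∘ zv))

/-- The pairs `(a, b)` that may replace each other in every equality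
`t(a, ū) = t(a, v̄)` with `T`-related parameters. -/
def Annihilates (L : FirstOrder.Language.{u, v}) (A : Type w) [L.Structure A]
    (T : A → A → Prop) (a b : A) : Prop :=
  ∀ (n : ℕ) (t : L.Term (Fin (n + 1))) (p q : Fin n → A), (∀ i, T (p i) (q i)) →
    (t.realize (Fin.cons a p) = t.realize (Fin.cons a q) ↔
      t.realize (Fin.cons b p) = t.realize (Fin.cons b q))

/-- Compatibility of a set of `2 × 2` matrices `[p q; r s]` with the operations of `A`. -/
def MatrixCompatible (L : FirstOrder.Language.{u, v}) (A : Type w) [L.Structure A]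
    (X : A → A → A → A → Prop) : Prop :=
  ∀ (n : ℕ) (f : L.Functions n) (p q r s : Fin n → A),
    (∀ i, X (p i) (q i) (r i) (s i)) → X (funMap f p) (funMap f q) (funMap f r) (funMap f s)

/-- The `T, T`-matrices `[p q; r s]`. -/
inductive TMatrix (L : FirstOrder.Language.{u, v}) (A : Type w) [L.Structure A]
    (T : A → A → Prop) : A → A → A → A → Prop
  | vert {x y : A} : T x y → TMatrix L A T x x y y
  | horiz {x y : A} : T x y → TMatrix L A T x y x y
  | app {n : ℕ} (f : L.Functions n) {p q r s : Fin n → A} :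
      (∀ i, TMatrix L A T (p i) (q i) (r i) (s i)) →
      TMatrix L A T (funMap f p) (funMap f q) (funMap f r) (funMap f s)

/-- Horizontal composites of matrices in `X`. -/
def HComp {A : Type w} (X : A → A → A → A → Prop) (p q r s : A) : Prop :=
  ∃ m m', X p m r m' ∧ X m q m' s

/-- Vertical composites of matrices in `X`. -/
def VComp {A : Type w} (X : A → A → A → A → Prop) (p q r s : A) : Prop :=
  ∃ m m', X p q m m' ∧ X m m' r s

/-- Sets of matrices containing the `T, T`-matrices, with enough closure properties, in which
a matrix with equal top entries and `T`-related bottom entries has equal bottom entries. -/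
structure IsCancellative (L : FirstOrder.Language.{u, v}) (A : Type w) [L.Structure A]
    (T : A → A → Prop) (X : A → A → A → A → Prop) : Prop where
  compat : MatrixCompatible L A X
  vert : ∀ {x y}, T x y → X x x y y
  horiz : ∀ {x y}, T x y → X x y x y
  hflip : ∀ {p q r s}, X p q r s → X q p s r
  vflip : ∀ {p q r s}, X p q r s → X r s p q
  hdeg : ∀ {p q r s}, X p q r s → X p p r r
  vdeg : ∀ {p q r s}, X p q r s → X p q p q
  row : ∀ {p q r s}, X p q r s → Annihilates L A T p q
  col : ∀ {p q r s}, X p q r s → Annihilates L A T p r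
  cancel : ∀ {p r s}, X p p r s → T r s → r = s

/-- A term operation `t` on `A` witnessing the Taylor identities. -/
def IsTaylorOn (L : FirstOrder.Language.{u, v}) (A : Type w) [L.Structure A] {n : ℕ}
    (t : L.Term (Fin n)) : Prop :=
  (∀ a : A, t.realize (fun _ => a) = a) ∧
    ∀ i : Fin n, ∃ wv zv : Fin n → ℕ, wv i ≠ zv i ∧
      ∀ val : ℕ → A, t.realize (val ∘ wv) = t.realize (val ∘ zv)

section

variable {L : FirstOrder.Language.{u, v}} {A : Type w} [L.Structure A]
  {T : A → A → Prop} {X : A → A → A → A → Prop}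

theorem Annihilates.refl (a : A) : Annihilates L A T a a := fun _ _ _ _ _ => Iff.rfl

theorem Annihilates.symm {a b : A} (h : Annihilates L A T a b) : Annihilates L A T b a :=
  fun n t p q hpq => (h n t p q hpq).symm

theorem Annihilates.trans {a b c : A} (h : Annihilates L A T a b)
    (h' : Annihilates L A T b c) : Annihilates L A T a c :=
  fun n t p q hpq => (h n t p q hpq).trans (h' n t p q hpq)

theorem Annihilates.of_rel (hT : IsTolerance L A T) (hC : Centralizes L A T T Eq) {a b : A}
    (h : T a b) : Annihilates L A T a b :=
  fun n t p q hpq => ⟨hC n t a b h p q hpq, hC n t b a (hT.2.1 h) p q hpq⟩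

theorem Compatible.realize {R : A → A → Prop} (hR : Compatible L A R) {α : Type*}
    (t : L.Term α) {p q : α → A} (h : ∀ x, R (p x) (q x)) : R (t.realize p) (t.realize q) := by
  induction t with
  | var x => exact h x
  | func f ts ih => exact hR _ f _ _ ih

theorem MatrixCompatible.realize (hX : MatrixCompatible L A X) {α : Type*}
    (t : L.Term α) {p q r s : α → A} (h : ∀ x, X (p x) (q x) (r x) (s x)) :
    X (t.realize p) (t.realize q) (t.realize r) (t.realize s) := by
  induction t with
  | var x => exact h x
  | func f ts ih => exact hX _ f _ _ _ _ ih

/-- Every term only involves finitely many variables. -/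
theorem exists_fin_term {α : Type*} (t : L.Term α) :
    ∃ (n : ℕ) (t' : L.Term (Fin n)) (e : Fin n → α),
      ∀ val : α → A, t.realize val = t'.realize (val ∘ e) := by
  classical
  let g := t.varFinset.equivFin
  refine ⟨_, t.restrictVar g, fun i => (g.symm i).1, fun val => ?_⟩
  rw [FirstOrder.Language.Term.realize_restrictVar]
  intro a
  simp [g]

theorem realize_eq_of_matrix_fin (hT : IsTolerance L A T) {n : ℕ} (t : L.Term (Fin n))
    {p q r s : Fin n → A}
    (h : ∀ x, (p x = q x ∧ r x = s x ∧ Annihilates L A T (p x) (r x)) ∨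
      (p x = r x ∧ q x = s x ∧ T (p x) (q x)))
    (hpq : t.realize p = t.realize q) : t.realize r = t.realize s := by
  classical
  suffices H : ∀ S : Finset (Fin n), t.realize (fun x => if x ∈ S then r x else p x) =
      t.realize (fun x => if x ∈ S then s x else q x) by simpa using H Finset.univ
  intro S
  induction S using Finset.induction_on with
  | empty => simpa using hpq
  | insert x₀ S hx₀ ih =>
    rcases h x₀ with ⟨h1, h2, h3⟩ | ⟨h1, h2, -⟩
    · let ρ : Fin n → Fin (n + 1) := fun x => if x = x₀ then 0 else x.succ
      have key : ∀ (a : A) (g : Fin n → A),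
          (t.relabel ρ).realize (Fin.cons a g : Fin (n + 1) → A) =
            t.realize (fun x => if x = x₀ then a else g x) := by
        intro a g
        rw [FirstOrder.Language.Term.realize_relabel]
        congr 1
        funext x
        by_cases hx : x = x₀ <;> simp [ρ, hx]
      have := h3 n (t.relabel ρ) (fun x => if x ∈ S then r x else p x)
        (fun x => if x ∈ S then s x else q x) (by
          intro x
          rcases h x with ⟨h1, h2, -⟩ | ⟨h1, h2, h3⟩
          · simp only [h1, h2]; exact hT.1 _
          · simpa only [← h1, ← h2, ite_self] using h3)
      rw [key, key, key, key] at this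
      convert this.1 ?_ using 2
      · funext x; by_cases hx : x = x₀ <;> simp [hx]
      · funext x; by_cases hx : x = x₀ <;> simp [hx, h2]
      · convert ih using 2
        · funext x; by_cases hx : x = x₀ <;> simp [hx, hx₀]
        · funext x; by_cases hx : x = x₀ <;> simp [hx, hx₀, h1]
    · convert ih using 2
      · funext x; by_cases hx : x = x₀ <;> simp [hx, hx₀, h1]
      · funext x; by_cases hx : x = x₀ <;> simp [hx, hx₀, h2]

theorem realize_eq_of_matrix (hT : IsTolerance L A T) {α : Type*} (t : L.Term α)
    {p q r s : α → A}
    (h : ∀ x, (p x = q x ∧ r x = s x ∧ Annihilates L A T (p x) (r x)) ∨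
      (p x = r x ∧ q x = s x ∧ T (p x) (q x)))
    (hpq : t.realize p = t.realize q) : t.realize r = t.realize s := by
  obtain ⟨n, t', e, he⟩ := exists_fin_term (A := A) t
  rw [he, he] at hpq ⊢
  exact realize_eq_of_matrix_fin hT t' (fun x => h (e x)) hpq

theorem TMatrix.exists_term {p q r s : A} (h : TMatrix L A T p q r s) :
    ∃ t : L.Term {m : A × A × A × A // (m.1 = m.2.1 ∧ m.2.2.1 = m.2.2.2 ∧ T m.1 m.2.2.1) ∨
        (m.1 = m.2.2.1 ∧ m.2.1 = m.2.2.2 ∧ T m.1 m.2.1)},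
      t.realize (fun m => m.1.1) = p ∧ t.realize (fun m => m.1.2.1) = q ∧
      t.realize (fun m => m.1.2.2.1) = r ∧ t.realize (fun m => m.1.2.2.2) = s := by
  induction h with
  | @vert x y h => exact ⟨.var ⟨(x, x, y, y), by simp [h]⟩, by simp⟩
  | @horiz x y h => exact ⟨.var ⟨(x, y, x, y), by simp [h]⟩, by simp⟩
  | app f _ ih =>
    choose ts h1 h2 h3 h4 using ih
    exact ⟨.func f ts, by simp [h1, h2, h3, h4]⟩

theorem TMatrix.rel (hT : IsTolerance L A T) {p q r s : A} (h : TMatrix L A T p q r s) :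
    T p q ∧ T p r := by
  induction h with
  | vert h => exact ⟨hT.1 _, h⟩
  | horiz h => exact ⟨h, hT.1 _⟩
  | app f _ ih => exact ⟨hT.2.2 _ f _ _ fun i => (ih i).1, hT.2.2 _ f _ _ fun i => (ih i).2⟩

theorem isCancellative_tMatrix (hT : IsTolerance L A T) (hC : Centralizes L A T T Eq) :
    IsCancellative L A T (TMatrix L A T) where
  compat _ f _ _ _ _ h := .app f h
  vert := .vert
  horiz := .horiz
  hflip h := by
    induction h with
    | vert h => exact .vert h
    | horiz h => exact .horiz (hT.2.1 h)
    | app f _ ih => exact .app f ih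
  vflip h := by
    induction h with
    | vert h => exact .vert (hT.2.1 h)
    | horiz h => exact .horiz h
    | app f _ ih => exact .app f ih
  hdeg h := by
    induction h with
    | vert h => exact .vert h
    | horiz h => exact .vert (hT.1 _)
    | app f _ ih => exact .app f ih
  vdeg h := by
    induction h with
    | vert h => exact .vert (hT.1 _)
    | horiz h => exact .horiz h
    | app f _ ih => exact .app f ih
  row h := .of_rel hT hC (h.rel hT).1
  col h := .of_rel hT hC (h.rel hT).2
  cancel h _ := by
    obtain ⟨t, h1, h2, rfl, rfl⟩ := h.exists_term
    refine realize_eq_of_matrix hT t (fun m => ?_) (h1.trans h2.symm)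
    exact m.2.imp_left fun h => ⟨h.1, h.2.1, .of_rel hT hC h.2.2⟩

/-- `T`-related elements that are not separated by any coordinate of a Taylor term are equal. -/
theorem eq_of_forall_update_eq (hT : IsTolerance L A T) (hC : Centralizes L A T T Eq)
    {n : ℕ} {t : L.Term (Fin n)} (ht : IsTaylorOn L A t) {r s : A} (hrs : T r s)
    (h : ∀ i, ∃ c : Fin n → A, (∀ j, Annihilates L A T r (c j)) ∧
      t.realize (Function.update c i r) = t.realize (Function.update c i s)) : r = s := by
  classical
  suffices H : ∀ S : Finset (Fin n), t.realize (fun x => if x ∈ S then s else r) = r by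
    simpa [ht.1] using (H Finset.univ).symm
  intro S
  induction S using Finset.induction_on with
  | empty => simpa using ht.1 r
  | insert i S hi ih =>
    obtain ⟨c, hc, hci⟩ := h i
    have hrs' := Annihilates.of_rel hT hC hrs
    have := realize_eq_of_matrix hT t (r := Function.update (fun x => if x ∈ S then s else r) i r)
      (s := Function.update (fun x => if x ∈ S then s else r) i s) (fun j => by
        by_cases hj : j = i
        · subst hj; simp [hrs]
        · left
          simp only [Function.update_of_ne hj, true_and]
          split_ifs
          · exact (hc j).symm.trans hrs'
          · exact (hc j).symm) hci
    refine Eq.trans ?_ (this.symm.trans (Eq.trans ?_ ih))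
    · congr 1; funext x; by_cases hx : x = i
      · subst hx; simp
      · simp [hx]
    · congr 1; funext x; by_cases hx : x = i
      · subst hx; simp [hi]
      · simp [hx]

theorem IsCancellative.le_hComp (hX : IsCancellative L A T X) {p q r s : A}
    (h : X p q r s) : HComp X p q r s := ⟨q, s, h, hX.hdeg (hX.hflip h)⟩

theorem IsCancellative.le_vComp (hX : IsCancellative L A T X) {p q r s : A}
    (h : X p q r s) : VComp X p q r s := ⟨r, s, h, hX.vdeg (hX.vflip h)⟩

theorem IsCancellative.eq_of_hComp (hT : IsTolerance L A T) (hC : Centralizes L A T T Eq)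
    {n : ℕ} {t : L.Term (Fin n)} (ht : IsTaylorOn L A t) (hX : IsCancellative L A T X)
    {p r s : A} (h : HComp X p p r s) (hrs : T r s) : r = s := by
  classical
  obtain ⟨m, m', h1, h2⟩ := h
  replace h2 := hX.hflip h2
  refine eq_of_forall_update_eq hT hC ht hrs fun i => ?_
  obtain ⟨wv, zv, hi, hwz⟩ := ht.2 i
  let val : A → A → ℕ → A := fun x y k => if k = wv i then x else y
  have hci : val r m' (wv i) = r := by simp [val]
  have hc : Function.update (val r m' ∘ wv) i r = val r m' ∘ wv := by
    rw [Function.update_eq_self_iff]; exact hci.symm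
  refine ⟨val r m' ∘ wv, fun j => ?_, ?_⟩
  · simp only [Function.comp, val]
    split_ifs
    · exact .refl _
    · exact hX.row (hX.vflip h1)
  · rw [hc, hwz]
    have hM : X (t.realize (val p m ∘ wv)) (t.realize (val p m ∘ zv))
        (t.realize (Function.update (val r m' ∘ wv) i s)) (t.realize (val r m' ∘ zv)) := by
      refine hX.compat.realize t fun j => ?_
      by_cases hj : j = i
      · subst hj
        simpa [val, hi.symm] using h2
      · simp only [Function.update_of_ne hj, Function.comp, val]
        split_ifs
        · exact hX.hdeg h1
        · exact h1
        · exact hX.hflip h1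
        · exact hX.hdeg (hX.hflip h1)
    rw [← hwz] at hM
    refine (hX.cancel hM ?_).symm
    rw [← hwz, ← hc]
    refine hT.2.2.realize t fun j => ?_
    by_cases hj : j = i
    · subst hj; simpa using hT.2.1 hrs
    · simpa [hj] using hT.1 _

theorem IsCancellative.eq_of_vComp (hT : IsTolerance L A T) (hC : Centralizes L A T T Eq)
    {n : ℕ} {t : L.Term (Fin n)} (ht : IsTaylorOn L A t) (hX : IsCancellative L A T X)
    {p r s : A} (h : VComp X p p r s) (hrs : T r s) : r = s := by
  classical
  obtain ⟨m, m', h1, h2⟩ := h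
  have hpr := (hX.col h1).trans (hX.col h2)
  replace h1 := hX.vflip h1
  refine eq_of_forall_update_eq hT hC ht hrs fun i => ?_
  obtain ⟨wv, zv, hi, hwz⟩ := ht.2 i
  let val : A → A → ℕ → A := fun x y k => if k = wv i then x else y
  have hw : Function.update (val r s ∘ wv) i r = val r s ∘ wv := by
    rw [Function.update_eq_self_iff]; simp [val]
  have hz : Function.update (val r s ∘ zv) i s = val r s ∘ zv := by
    rw [Function.update_eq_self_iff]; simp [val, hi.symm]
  have hT' : ∀ k l, T (val r s k) (val r s l) := by
    intro k l
    simp only [val]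
    split_ifs
    exacts [hT.1 _, hrs, hT.2.1 hrs, hT.1 _]
  have hp : t.realize (Function.update (val r s ∘ wv) i p) =
      t.realize (Function.update (val r s ∘ zv) i p) := by
    have hM : X (t.realize (val m m' ∘ wv)) (t.realize (val m m' ∘ zv))
        (t.realize (Function.update (val r s ∘ wv) i p))
        (t.realize (Function.update (val r s ∘ zv) i p)) := by
      refine hX.compat.realize t fun j => ?_
      by_cases hj : j = i
      · subst hj
        simpa [val, hi.symm] using h1
      · simp only [Function.update_of_ne hj, Function.comp, val]
        split_ifs
        · exact hX.hdeg h2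
        · exact h2
        · exact hX.hflip h2
        · exact hX.hdeg (hX.hflip h2)
    rw [← hwz] at hM
    refine hX.cancel hM (hT.2.2.realize t fun j => ?_)
    by_cases hj : j = i
    · subst hj; simpa using hT.1 _
    · simpa [hj] using hT' _ _
  have hr : t.realize (Function.update (val r s ∘ wv) i r) =
      t.realize (Function.update (val r s ∘ zv) i r) := by
    refine realize_eq_of_matrix hT t (fun j => ?_) hp
    by_cases hj : j = i
    · subst hj; simp [hpr]
    · right; simpa [hj] using hT' _ _
  refine ⟨val r s ∘ zv, fun j => ?_, ?_⟩
  · have := Annihilates.of_rel hT hC (hT' (wv i) (zv j))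
    simpa [val] using this
  · rw [hz, ← hr, hw, hwz]

theorem IsCancellative.hComp (hT : IsTolerance L A T) (hC : Centralizes L A T T Eq)
    {n : ℕ} {t : L.Term (Fin n)} (ht : IsTaylorOn L A t) (hX : IsCancellative L A T X) :
    IsCancellative L A T (HComp X) where
  compat _ f _ _ _ _ h := by
    choose m m' h1 h2 using h
    exact ⟨_, _, hX.compat _ f _ _ _ _ h1, hX.compat _ f _ _ _ _ h2⟩
  vert h := hX.le_hComp (hX.vert h)
  horiz h := hX.le_hComp (hX.horiz h)
  hflip := fun ⟨m, m', h1, h2⟩ => ⟨m, m', hX.hflip h2, hX.hflip h1⟩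
  vflip := fun ⟨m, m', h1, h2⟩ => ⟨m', m, hX.vflip h1, hX.vflip h2⟩
  hdeg := fun ⟨_, _, h1, _⟩ => hX.le_hComp (hX.hdeg h1)
  vdeg := fun ⟨m, _, h1, h2⟩ => ⟨m, m, hX.vdeg h1, hX.vdeg h2⟩
  row := fun ⟨_, _, h1, h2⟩ => (hX.row h1).trans (hX.row h2)
  col := fun ⟨_, _, h1, _⟩ => hX.col h1
  cancel := hX.eq_of_hComp hT hC ht

theorem IsCancellative.vComp (hT : IsTolerance L A T) (hC : Centralizes L A T T Eq)
    {n : ℕ} {t : L.Term (Fin n)} (ht : IsTaylorOn L A t) (hX : IsCancellative L A T X) :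
    IsCancellative L A T (VComp X) where
  compat _ f _ _ _ _ h := by
    choose m m' h1 h2 using h
    exact ⟨_, _, hX.compat _ f _ _ _ _ h1, hX.compat _ f _ _ _ _ h2⟩
  vert h := hX.le_vComp (hX.vert h)
  horiz h := hX.le_vComp (hX.horiz h)
  hflip := fun ⟨m, m', h1, h2⟩ => ⟨m', m, hX.hflip h1, hX.hflip h2⟩
  vflip := fun ⟨m, m', h1, h2⟩ => ⟨m, m', hX.vflip h2, hX.vflip h1⟩
  hdeg := fun ⟨m, _, h1, h2⟩ => ⟨m, m, hX.hdeg h1, hX.hdeg h2⟩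
  vdeg := fun ⟨_, _, h1, _⟩ => hX.le_vComp (hX.vdeg h1)
  row := fun ⟨_, _, h1, _⟩ => hX.row h1
  col := fun ⟨_, _, h1, h2⟩ => (hX.col h1).trans (hX.col h2)
  cancel := hX.eq_of_vComp hT hC ht

/-- The `T, T`-matrices lie in a cancellative set of matrices closed under both compositions. -/
theorem exists_isCancellative_closed (hT : IsTolerance L A T) (hC : Centralizes L A T T Eq)
    {n : ℕ} {t : L.Term (Fin n)} (ht : IsTaylorOn L A t) :
    ∃ X, IsCancellative L A T X ∧ (∀ {p q r s}, HComp X p q r s → X p q r s) ∧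
      (∀ {p q r s}, VComp X p q r s → X p q r s) := by
  let Y : ℕ → A → A → A → A → Prop := Nat.rec (TMatrix L A T) fun _ X => VComp (HComp X)
  have hY : ∀ k, IsCancellative L A T (Y k) := by
    intro k
    induction k with
    | zero => exact isCancellative_tMatrix hT hC
    | succ k ih => exact (ih.hComp hT hC ht).vComp hT hC ht
  have hstep : ∀ k, Y k ≤ Y (k + 1) := fun k p q r s h =>
    ((hY k).hComp hT hC ht).le_vComp ((hY k).le_hComp h)
  have hmono : Monotone Y := monotone_nat_of_le_succ hstep
  have mono : ∀ {k l}, k ≤ l → ∀ {p q r s}, Y k p q r s → Y l p q r s :=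
    fun h p q r s hp => hmono h p q r s hp
  refine ⟨fun p q r s => ∃ k, Y k p q r s, ?_, ?_, ?_⟩
  · exact {
      compat := fun n f p q r s h => by
        choose k hk using h
        exact ⟨Finset.univ.sup k, (hY _).compat n f p q r s fun i =>
          mono (Finset.le_sup (Finset.mem_univ i)) (hk i)⟩
      vert := fun h => ⟨0, .vert h⟩
      horiz := fun h => ⟨0, .horiz h⟩
      hflip := fun ⟨k, h⟩ => ⟨k, (hY k).hflip h⟩
      vflip := fun ⟨k, h⟩ => ⟨k, (hY k).vflip h⟩
      hdeg := fun ⟨k, h⟩ => ⟨k, (hY k).hdeg h⟩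
      vdeg := fun ⟨k, h⟩ => ⟨k, (hY k).vdeg h⟩
      row := fun ⟨k, h⟩ => (hY k).row h
      col := fun ⟨k, h⟩ => (hY k).col h
      cancel := fun ⟨k, h⟩ => (hY k).cancel h }
  · rintro p q r s ⟨m, m', ⟨k, h1⟩, ⟨l, h2⟩⟩
    exact ⟨max k l + 1, ((hY _).hComp hT hC ht).le_vComp
      ⟨m, m', mono (le_max_left k l) h1, mono (le_max_right k l) h2⟩⟩
  · rintro p q r s ⟨m, m', ⟨k, h1⟩, ⟨l, h2⟩⟩
    exact ⟨max k l + 1, m, m', (hY _).le_hComp (mono (le_max_left k l) h1),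
      (hY _).le_hComp (mono (le_max_right k l) h2)⟩

/-- In the presence of a Taylor term, an abelian tolerance `T` is contained in a congruence `θ`
that is abelian modulo a congruence `δ` meeting `T` trivially. -/
theorem exists_congruence_centralizes (hT : IsTolerance L A T) (hC : Centralizes L A T T Eq)
    {n : ℕ} {t : L.Term (Fin n)} (ht : IsTaylorOn L A t) :
    ∃ θ δ : A → A → Prop, IsCongruence L A θ ∧ IsCongruence L A δ ∧ (∀ x y, T x y → θ x y) ∧
      (∀ x y, δ x y → θ x y) ∧ Centralizes L A θ θ δ ∧ ∀ x y, δ x y → T x y → x = y := by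
  obtain ⟨X, hX, hH, hV⟩ := exists_isCancellative_closed hT hC ht
  have const : ∀ x, X x x x x := fun x => hX.vert (hT.1 x)
  have move : ∀ {p x y z}, X p p x y → X z z p p → X z z x y := fun h h' => hV ⟨_, _, h', h⟩
  have left : ∀ {p x y}, X p p x y → X x x x y := fun h => move h (hX.vflip (hX.hdeg h))
  let θ : A → A → Prop := fun x y => X x x y y ∧ X x y x y
  let δ : A → A → Prop := fun x y => X x x x y
  have hθ : IsCongruence L A θ :=
    ⟨⟨fun x => ⟨const x, const x⟩, fun x y h => ⟨hX.vflip h.1, hX.hflip h.2⟩,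
      fun n f a b h => ⟨hX.compat n f _ _ _ _ fun i => (h i).1,
        hX.compat n f _ _ _ _ fun i => (h i).2⟩⟩,
      fun x y z h h' => ⟨hV ⟨_, _, h.1, h'.1⟩, hH ⟨_, _, h.2, h'.2⟩⟩⟩
  have hδsymm : ∀ {x y}, δ x y → δ y x := fun h => left (hX.hflip h)
  have hδ : IsCongruence L A δ :=
    ⟨⟨const, fun x y h => hδsymm h, fun n f a b h => hX.compat n f _ _ _ _ h⟩,
      fun x y z h h' => left (hH ⟨_, _, hX.hflip (hδsymm h), h'⟩)⟩
  refine ⟨θ, δ, hθ, hδ, fun x y h => ⟨hX.vert h, hX.horiz h⟩,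
    fun x y h => ⟨hX.hdeg (hX.hflip h), hX.vdeg (hX.vflip h)⟩, ?_, fun x y h h' => hX.cancel h h'⟩
  intro n t a b hab p q hpq hδt
  refine left (hV ⟨_, _, hδt, hX.compat.realize t fun i => ?_⟩)
  refine Fin.cases ?_ (fun i => ?_) i
  · exact hab.1
  · exact (hpq i).2

/-- The quotient of `A` by an equivalence relation, with operations computed on
representatives. -/
@[reducible]
noncomputable def quotientAlgebra (L : FirstOrder.Language.{u, v}) {A : Type w} [L.Structure A]
    (S : Setoid A) : L.Structure (Quotient S) where
  funMap f x := Quotient.mk S (funMap f fun i => (x i).out)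
  RelMap _ _ := False

theorem quotientAlgebra_realize {S : Setoid A} (hS : Compatible L A S) {α : Type*}
    (t : L.Term α) (val : α → A) :
    letI := quotientAlgebra L S
    t.realize (fun x => Quotient.mk S (val x)) = Quotient.mk S (t.realize val) := by
  let := quotientAlgebra L S
  induction t with
  | var x => rfl
  | func f ts ih =>
    simp only [FirstOrder.Language.Term.realize_func, ih]
    exact Quotient.sound (hS _ f _ _ fun i => Quotient.mk_out _)

/-- A weak difference term behaves as a Maltsev term, modulo `δ`, on a congruence `θ ⊇ δ` that is
abelian modulo `δ`. -/
theorem IsWeakDifferenceTerm.rel_of_centralizes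
    {E : Set (Σ n : ℕ, L.Term (Fin n) × L.Term (Fin n))} {wt : L.Term (Fin 3)}
    (hwt : IsWeakDifferenceTerm.{u, v, w} L E wt) (hA : SatisfiesEqs L A E)
    {θ δ : A → A → Prop} (hθ : IsCongruence L A θ) (hδ : IsCongruence L A δ)
    (hle : ∀ x y, δ x y → θ x y) (hC : Centralizes L A θ θ δ) {a b : A} (hab : θ a b) :
    δ (wt.realize ![a, a, b]) b ∧ δ (wt.realize ![b, a, a]) b := by
  let S : Setoid A := ⟨δ, hδ.1.1, fun h => hδ.1.2.1 h, fun h h' => hδ.2 h h'⟩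
  have hS : Compatible L A S := hδ.1.2.2
  let := quotientAlgebra L S
  have hout : ∀ x : A, θ (Quotient.mk S x).out x := fun x => hle _ _ (Quotient.mk_out (s := S) x)
  have hmk : ∀ {α : Type} (t : L.Term α) (val : α → Quotient S),
      t.realize val = Quotient.mk S (t.realize fun x => (val x).out) := by
    intro α t val
    rw [← quotientAlgebra_realize hS]
    simp
  have hE : SatisfiesEqs L (Quotient S) E := by
    intro e he val
    rw [hmk, hmk, hA e he]
  let β : Quotient S → Quotient S → Prop := fun x y => θ x.out y.out
  have hβ : IsCongruence L (Quotient S) β :=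
    ⟨⟨fun _ => hθ.1.1 _, fun _ _ h => hθ.1.2.1 h, fun n f x y h =>
      hθ.2 (hout _) (hθ.2 (hθ.1.2.2 n f _ _ h) (hθ.1.2.1 (hout _)))⟩, fun _ _ _ h h' => hθ.2 h h'⟩
  have hcons : ∀ {n : ℕ} (x : Quotient S) (p : Fin n → Quotient S),
      (fun i => ((Fin.cons x p : Fin (n + 1) → Quotient S) i).out) =
        (Fin.cons x.out fun i => (p i).out : Fin (n + 1) → A) := by
    intro n x p
    funext i
    refine Fin.cases rfl (fun i => rfl) i
  have hβC : Centralizes L (Quotient S) β β Eq := by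
    intro n t x y hxy p q hpq h
    rw [hmk, hmk, hcons, hcons] at h ⊢
    exact Quotient.sound (hC n t _ _ hxy _ _ hpq (Quotient.exact h))
  have hβab : β (Quotient.mk S a) (Quotient.mk S b) :=
    hθ.2 (hout a) (hθ.2 hab (hθ.1.2.1 (hout b)))
  have hvec : ∀ x y z : A, wt.realize ![Quotient.mk S x, Quotient.mk S y, Quotient.mk S z] =
      Quotient.mk S (wt.realize ![x, y, z]) := by
    intro x y z
    rw [← quotientAlgebra_realize hS]
    congr 1
    funext i
    fin_cases i <;> rfl
  obtain ⟨h1, h2⟩ := hwt _ hE β hβ hβC _ _ hβab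
  rw [hvec] at h1 h2
  exact ⟨Quotient.exact h1, Quotient.exact h2⟩

theorem IsWeakDifferenceTerm.realize_self
    {E : Set (Σ n : ℕ, L.Term (Fin n) × L.Term (Fin n))} {wt : L.Term (Fin 3)}
    (hwt : IsWeakDifferenceTerm.{u, v, w} L E wt) (hA : SatisfiesEqs L A E) (a : A) :
    wt.realize ![a, a, a] = a := by
  refine (hwt A hA Eq ⟨⟨fun _ => rfl, fun _ _ => Eq.symm, ?_⟩, fun _ _ _ => Eq.trans⟩ ?_ a a rfl).1
  · intro n f x y h
    rw [funext h]
  · rintro n t x y rfl p q - h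
    exact h

end

/-- If a variety with a Taylor term has a weak difference term, then it has a weak
difference term for tolerances. -/
theorem exists_weak_difference_term_for_tolerances {L : FirstOrder.Language.{u, v}}
    (E : Set (Σ n : ℕ, L.Term (Fin n) × L.Term (Fin n)))
    (hTaylor : HasTaylorTerm.{u, v, w} L E)
    (hW : ∃ wt : L.Term (Fin 3), IsWeakDifferenceTerm.{u, v, w} L E wt) :
    ∃ wt : L.Term (Fin 3),
      ∀ (A : Type w) [L.Structure A], SatisfiesEqs L A E →
        ∀ T : A → A → Prop, IsTolerance L A T → Centralizes L A T T Eq →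
          ∀ a b : A, T a b → wt.realize ![a, a, b] = b ∧ wt.realize ![b, a, a] = b := by
  obtain ⟨n, t, -, hidem, htaylor⟩ := hTaylor
  obtain ⟨wt, hwt⟩ := hW
  refine ⟨wt, fun A _ hA T hT hC a b hab => ?_⟩
  have ht : IsTaylorOn L A t := by
    refine ⟨hidem A hA, fun i => ?_⟩
    obtain ⟨wv, zv, hi, h⟩ := htaylor i
    exact ⟨wv, zv, hi, h A hA⟩
  obtain ⟨θ, δ, hθ, hδ, hTθ, hδθ, hθC, hδT⟩ := exists_congruence_centralizes hT hC ht
  obtain ⟨h1, h2⟩ := hwt.rel_of_centralizes hA hθ hδ hδθ hθC (hTθ a b hab)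
  have hself := hwt.realize_self hA b
  have hrel : ∀ x y z : A, T x b → T y b → T z b → T (wt.realize ![x, y, z]) b := by
    intro x y z hx hy hz
    conv_rhs => rw [← hself]
    refine hT.2.2.realize wt fun i => ?_
    fin_cases i
    exacts [hx, hy, hz]
  exact ⟨hδT _ _ h1 (hrel _ _ _ hab hab (hT.1 b)), hδT _ _ h2 (hrel _ _ _ (hT.1 b) hab hab)⟩
end

section
/- Let A be an algebra with congruences α, β, δ such that β ⊆ α, β ∩ δ is the equality relation, and α is abelian (i.e., C(α,α;0) holds). Then the tolerance S = δ∘β∘δ satisfies C(S,S;δ). -/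
open FirstOrder.Language FirstOrder.Language.Structure

universe u v w

/-- Composition of binary relations: `(a, c) ∈ R ∘ S` iff there is `b` with
`(a, b) ∈ R` and `(b, c) ∈ S`. -/
def RelComp {A : Type w} (R S : A → A → Prop) : A → A → Prop :=
  fun a c => ∃ b, R a b ∧ S b c

/-- A compatible relation is preserved by all term operations. -/
theorem Compatible.realize_term {L : FirstOrder.Language.{u, v}} {A : Type w} [L.Structure A]
    {T : A → A → Prop} (hT : Compatible L A T) {ι : Type*} (t : L.Term ι) {x y : ι → A}
    (h : ∀ i, T (x i) (y i)) : T (t.realize x) (t.realize y) := by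
  induction t with
  | var i => exact h i
  | func f ts ih => exact hT _ f _ _ ih

/-- A compatible relation is preserved by a term whose first variable is singled out. -/
theorem Compatible.realize_cons {L : FirstOrder.Language.{u, v}} {A : Type w} [L.Structure A]
    {T : A → A → Prop} (hT : Compatible L A T) {n : ℕ} (t : L.Term (Fin (n + 1))) {a b : A}
    {x y : Fin n → A} (hab : T a b) (h : ∀ i, T (x i) (y i)) :
    T (t.realize (Fin.cons a x)) (t.realize (Fin.cons b y)) :=
  hT.realize_term t (Fin.cases hab h)

/-- If `β ⊆ α`, `β ∩ δ` is the equality relation, and `α` is abelian, then the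
tolerance `S = δ ∘ β ∘ δ` satisfies `C(S, S; δ)`. -/
theorem centralizes_comp_of_abelian {L : FirstOrder.Language.{u, v}}
    {A : Type w} [L.Structure A] (α β δ : A → A → Prop)
    (hα : IsCongruence L A α) (hβ : IsCongruence L A β) (hδ : IsCongruence L A δ)
    (hβα : ∀ a b, β a b → α a b)
    (hβδ : (fun a b => β a b ∧ δ a b) = (fun a b => a = b))
    (hab : Centralizes L A α α Eq) :
    Centralizes L A (RelComp (RelComp δ β) δ) (RelComp (RelComp δ β) δ) δ := by
  obtain ⟨⟨-, symmδ, compδ⟩, transδ⟩ := hδ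
  obtain ⟨⟨reflβ, -, compβ⟩, -⟩ := hβ
  rintro n t a b ⟨b', ⟨a', haa', hab'⟩, hbb'⟩ u v huv h
  choose v' huv' hvv' using huv
  choose u' huu' huv' using huv'
  have hδa : δ (t.realize (Fin.cons a' u')) (t.realize (Fin.cons a' v')) :=
    transδ (symmδ (compδ.realize_cons t haa' huu'))
      (transδ h (compδ.realize_cons t haa' fun i => symmδ (hvv' i)))
  have hβa : β (t.realize (Fin.cons a' u')) (t.realize (Fin.cons a' v')) :=
    compβ.realize_cons t (reflβ a') huv'
  have heq : t.realize (Fin.cons a' u') = t.realize (Fin.cons a' v') :=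
    (congrFun₂ hβδ _ _).mp ⟨hβa, hδa⟩
  have hb := hab n t a' b' (hβα _ _ hab') u' v' (fun i => hβα _ _ (huv' i)) heq
  have hδb : δ (t.realize (Fin.cons b u)) (t.realize (Fin.cons b' u')) :=
    compδ.realize_cons t (symmδ hbb') huu'
  rw [hb] at hδb
  exact transδ hδb (compδ.realize_cons t hbb' hvv')
end

section
/- Let A be an algebra, Δ a congruence on A, and R a tolerance on A. If Δ ∩ (R∘R) is contained in the equality relation, then C(R,Δ;0) holds. -/
open FirstOrder.Language FirstOrder.Language.Structure

universe u v w

theorem Compatible.term_realize {L : FirstOrder.Language.{u, v}} {A : Type w} [L.Structure A]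
    {T : A → A → Prop} (hT : Compatible L A T) {α : Type*} (t : L.Term α) {x y : α → A}
    (hxy : ∀ i, T (x i) (y i)) : T (t.realize x) (t.realize y) := by
  induction t with
  | var i => exact hxy i
  | func f _ ih => exact hT _ f _ _ ih

/-- If `Δ` is a congruence, `R` a tolerance, and `Δ ∩ (R ∘ R)` is contained in the
equality relation, then `C(R, Δ; 0)` holds. -/
theorem centralizes_of_inter_comp_eq {L : FirstOrder.Language.{u, v}}
    {A : Type w} [L.Structure A] (Δ R : A → A → Prop)
    (hΔ : IsCongruence L A Δ) (hR : IsTolerance L A R)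
    (h : ∀ a b : A, Δ a b → RelComp R R a b → a = b) :
    Centralizes L A R Δ Eq := by
  obtain ⟨⟨hΔrefl, -, hΔcomp⟩, -⟩ := hΔ
  obtain ⟨hRrefl, hRsymm, hRcomp⟩ := hR
  intro n t a b hab u v huv heq
  have hR_cons (w : Fin n → A) :
      R (t.realize (Fin.cons a w)) (t.realize (Fin.cons b w)) :=
    hRcomp.term_realize t (Fin.cases hab fun i => hRrefl (w i))
  refine h _ _ (hΔcomp.term_realize t (Fin.cases (hΔrefl b) huv))
    ⟨t.realize (Fin.cons a u), hRsymm (hR_cons u), ?_⟩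
  rw [heq]
  exact hR_cons v
end

section
/- Let A be an algebra, T a tolerance on A, δ a congruence on A, and (αᵢ)_{i∈I} a family of congruences on A. If C(αᵢ,T;δ) holds for every i ∈ I, then C(⋁_{i∈I} αᵢ, T; δ) holds, where ⋁_{i∈I} αᵢ is the smallest congruence containing every αᵢ (equivalently, the transitive closure of their union). -/
open FirstOrder.Language FirstOrder.Language.Structure

universe u v w

/-- Theorem 2.19 (5) (semidistributivity in the first variable): if `C(αᵢ, T; δ)`
holds for all `i`, then `C(⋁ᵢ αᵢ, T; δ)` holds, where `⋁ᵢ αᵢ` is the transitive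
closure of the union of the `αᵢ`. -/
theorem centralizes_iSup {L : FirstOrder.Language.{u, v}}
    {A : Type w} [L.Structure A] {I : Type*} (αf : I → A → A → Prop)
    (T δ : A → A → Prop) (hα : ∀ i, IsCongruence L A (αf i))
    (hT : IsTolerance L A T) (hδ : IsCongruence L A δ)
    (h : ∀ i, Centralizes L A (αf i) T δ) :
    Centralizes L A (Relation.TransGen fun a b => ∃ i, αf i a b) T δ := by
  intro n t a b hab u v huv hδa
  induction hab with
  | single hac => exact hac.elim fun i hi => h i n t _ _ hi u v huv hδa
  | tail _ hcd ih => exact hcd.elim fun i hi => h i n t _ _ hi u v huv ih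
end
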